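/- arXiv:2503.22660 — 7 statements merged into one kernel-verified Lean document; each statement's English description precedes it below -/
import Mathlib

section
/- Let k < n be natural numbers, let j : Fin k → Fin n be a strictly increasing injection, let P be a finite set of points of ℝ^k (functions Fin k → ℝ), let L, U : (Fin k → ℝ) → ℝ, let f : (Fin k → ℝ) → ℝ, and let pl, pu : Fin n → ℝ. If the lifted triple (P', L', U') — where P' = {y : Fin n → ℝ : y∘j ∈ P and for every i not in the range of j, y i ∈ {pl i, pu i}}, L'(y) = L(y∘j), and U'(y) = U(y∘j) — encloses the lifted function F(y) = f(y∘j) in the convex-combination sense, then (P, L, U) encloses f in the convex-combination sense. -/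
/-- `(P, L, U)` encloses `f` in the convex-combination sense: for every finite family of
points of `P` and every convex combination vector, the convex combination of the `L`-values
(resp. `U`-values) bounds `f` at the corresponding convex combination of the points. -/
def Encloses {n : ℕ} (P : Set (Fin n → ℝ)) (L U f : (Fin n → ℝ) → ℝ) : Prop :=
  ∀ (m : ℕ) (v : Fin m → (Fin n → ℝ)) (θ : Fin m → ℝ),
    (∀ i, v i ∈ P) → (∀ i, 0 ≤ θ i) → (∑ i, θ i = 1) →
    ∑ i, θ i * L (v i) ≤ f (∑ i, θ i • v i) ∧
      f (∑ i, θ i • v i) ≤ ∑ i, θ i * U (v i)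

theorem lift_encloses_converse (k n : ℕ) (hkn : k < n) (j : Fin k → Fin n) (hj : StrictMono j)
    (P : Set (Fin k → ℝ)) (hP : P.Finite) (L U f : (Fin k → ℝ) → ℝ)
    (pl pu : Fin n → ℝ)
    (henc : Encloses
      {y : Fin n → ℝ | (y ∘ j) ∈ P ∧ ∀ i : Fin n, i ∉ Set.range j → y i ∈ ({pl i, pu i} : Set ℝ)}
      (fun y => L (y ∘ j)) (fun y => U (y ∘ j)) (fun y => f (y ∘ j))) :
    Encloses P L U f := by
  intro m v θ hv h0 h1
  have key : ∀ w : Fin k → ℝ, (Function.extend j w pl) ∘ j = w := fun w =>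
    Function.extend_comp hj.injective w pl
  have h := henc m (fun i => Function.extend j (v i) pl) θ (fun i => by
    refine ⟨by rw [key]; exact hv i, fun l hl => ?_⟩
    left
    exact Function.extend_apply' _ _ _ hl) h0 h1
  have hs : (∑ i, θ i • Function.extend j (v i) pl) ∘ j = ∑ i, θ i • v i := by
    funext l
    simp [Finset.sum_apply, hj.injective.extend_apply]
  simpa only [key, hs] using h
end

section
/- Let P be a finite set of points of ℝⁿ, let L, U : ℝⁿ → ℝ, and suppose (P, L, U) encloses f : ℝⁿ → ℝ in the convex-combination sense. Let Q be a finite set of points of ℝⁿ disjoint from P, and let L', U' : ℝⁿ → ℝ agree with L and U on P and be such that for every q ∈ Q there exist a finite family w₁,…,w_m of points of P and a convex combination vector μ₁,…,μ_m with q = μ₁w₁+⋯+μ_m w_m, L'(q) = μ₁L(w₁)+⋯+μ_m L(w_m), and U'(q) = μ₁U(w₁)+⋯+μ_m U(w_m). Then (P ∪ Q, L', U') encloses f in the convex-combination sense. -/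
theorem interpolation_encloses (n : ℕ) (P Q : Set (Fin n → ℝ))
    (hP : P.Finite) (hQ : Q.Finite) (hdisj : Disjoint P Q)
    (L U L' U' f : (Fin n → ℝ) → ℝ)
    (henc : Encloses P L U f)
    (hL : ∀ p ∈ P, L' p = L p) (hU : ∀ p ∈ P, U' p = U p)
    (hQrep : ∀ q ∈ Q, ∃ (m : ℕ) (w : Fin m → (Fin n → ℝ)) (μ : Fin m → ℝ),
      (∀ i, w i ∈ P) ∧ (∀ i, 0 ≤ μ i) ∧ (∑ i, μ i = 1) ∧
      q = ∑ i, μ i • w i ∧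
      L' q = ∑ i, μ i * L (w i) ∧ U' q = ∑ i, μ i * U (w i)) :
    Encloses (P ∪ Q) L' U' f := by
  intro M v θ hv hθ hsum
  have key : ∀ i, ∃ (m : ℕ) (w : Fin m → (Fin n → ℝ)) (μ : Fin m → ℝ),
      (∀ j, w j ∈ P) ∧ (∀ j, 0 ≤ μ j) ∧ (∑ j, μ j = 1) ∧
      v i = ∑ j, μ j • w j ∧
      L' (v i) = ∑ j, μ j * L (w j) ∧ U' (v i) = ∑ j, μ j * U (w j) := by
    intro i
    rcases hv i with h | h
    · exact ⟨1, fun _ => v i, fun _ => 1, by simp [h], by simp, by simp, by simp,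
        by simp [hL _ h], by simp [hU _ h]⟩
    · exact hQrep _ h
  choose m w μ hw hμ hμ1 hvw hLw hUw using key
  let e := (Fintype.equivFin ((i : Fin M) × Fin (m i))).symm
  have h1 : ∀ g : ((i : Fin M) × Fin (m i)) → ℝ,
      ∑ k, g (e k) = ∑ i, ∑ j, g ⟨i, j⟩ := fun g => by
    rw [Equiv.sum_comp e g, Fintype.sum_sigma]
  have h2 : ∀ g : ((i : Fin M) × Fin (m i)) → (Fin n → ℝ),
      ∑ k, g (e k) = ∑ i, ∑ j, g ⟨i, j⟩ := fun g => by
    rw [Equiv.sum_comp e g, Fintype.sum_sigma]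
  have H := henc _ (fun k => w (e k).1 (e k).2) (fun k => θ (e k).1 * μ (e k).1 (e k).2)
    (fun k => hw _ _) (fun k => mul_nonneg (hθ _) (hμ _ _))
    (by rw [h1 (fun p => θ p.1 * μ p.1 p.2)]; simp [← Finset.mul_sum, hμ1, hsum])
  rw [h1 (fun p => θ p.1 * μ p.1 p.2 * L (w p.1 p.2)),
    h1 (fun p => θ p.1 * μ p.1 p.2 * U (w p.1 p.2)),
    h2 (fun p => (θ p.1 * μ p.1 p.2) • w p.1 p.2)] at H
  simp only [mul_assoc, mul_smul, ← Finset.mul_sum, ← Finset.smul_sum, ← hvw, ← hLw, ← hUw] at H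
  exact H
end

section
/- Let P be a finite set of points of ℝⁿ, let L, U : ℝⁿ → ℝ, and suppose (P, L, U) encloses f : ℝⁿ → ℝ in the convex-combination sense. Then for every x in the convex hull of P, the point (x, f(x)) of ℝⁿ × ℝ lies in the convex hull of the vertex set V = {(p, L(p)) : p ∈ P} ∪ {(p, U(p)) : p ∈ P} (the polyhedron formed by the bounding set). -/
theorem encloses_mem_convexHull (n : ℕ) (P : Set (Fin n → ℝ)) (hP : P.Finite)
    (L U f : (Fin n → ℝ) → ℝ)
    (henc : Encloses P L U f) :
    ∀ x ∈ convexHull ℝ P,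
      ((x, f x) : (Fin n → ℝ) × ℝ) ∈
        convexHull ℝ ((fun p => (p, L p)) '' P ∪ (fun p => (p, U p)) '' P) := by
  intro x hx
  obtain ⟨ι, _, w, z, hw0, hw1, hz, rfl⟩ := mem_convexHull_iff_exists_fintype.1 hx
  let e := Fintype.equivFin ι
  have key := henc (Fintype.card ι) (fun i => z (e.symm i)) (fun i => w (e.symm i))
    (fun i => hz _) (fun i => hw0 _) (by rw [e.symm.sum_comp w]; exact hw1)
  rw [e.symm.sum_comp (fun i => w i • z i), e.symm.sum_comp (fun i => w i * L (z i)),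
    e.symm.sum_comp (fun i => w i * U (z i))] at key
  have pt : ∀ G : (Fin n → ℝ) → ℝ,
      (∀ p ∈ P, ((p, G p) : (Fin n → ℝ) × ℝ) ∈
        (fun p => (p, L p)) '' P ∪ (fun p => (p, U p)) '' P) →
      ((∑ i, w i • z i, ∑ i, w i * G (z i)) : (Fin n → ℝ) × ℝ) ∈
        convexHull ℝ ((fun p => (p, L p)) '' P ∪ (fun p => (p, U p)) '' P) := by
    intro G hG
    refine mem_convexHull_of_exists_fintype w (fun i => (z i, G (z i))) hw0 hw1
      (fun i => hG _ (hz i)) ?_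
    ext <;> simp [Prod.fst_sum, Prod.snd_sum]
  have hL := pt L (fun p hp => Or.inl ⟨p, hp, rfl⟩)
  have hU := pt U (fun p hp => Or.inr ⟨p, hp, rfl⟩)
  have hs : f (∑ i, w i • z i) ∈ segment ℝ (∑ i, w i * L (z i)) (∑ i, w i * U (z i)) := by
    rw [segment_eq_Icc (key.1.trans key.2)]
    exact key
  obtain ⟨a, b, ha, hb, hab, h⟩ := hs
  have := (convex_convexHull ℝ _) hL hU ha hb hab
  convert this using 1
  ext1
  · simp only [Prod.smul_mk, Prod.mk_add_mk]
    rw [← add_smul, hab, one_smul]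
  · simp only [Prod.smul_mk, Prod.mk_add_mk]
    exact h.symm
end

section
/- Let p₀,…,p_m be an affinely independent family of points of ℝⁿ, let L₀,…,L_m and U₀,…,U_m be real numbers with L_i ≤ U_i for every i, let θ₀,…,θ_m be a convex combination vector, and set x = θ₀p₀+⋯+θ_m p_m. Then for every real y, the point (x, y) of ℝⁿ × ℝ lies in the convex hull of {(p₀, L₀),…,(p_m, L_m)} ∪ {(p₀, U₀),…,(p_m, U_m)} if and only if θ₀L₀+⋯+θ_m L_m ≤ y ≤ θ₀U₀+⋯+θ_m U_m. -/
theorem mem_convexHull_iff_between_bounds (n m : ℕ)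
    (p : Fin (m + 1) → (Fin n → ℝ)) (hp : AffineIndependent ℝ p)
    (L U : Fin (m + 1) → ℝ) (hLU : ∀ i, L i ≤ U i)
    (θ : Fin (m + 1) → ℝ) (hθ : ∀ i, 0 ≤ θ i) (hθ1 : ∑ i, θ i = 1)
    (x : Fin n → ℝ) (hx : x = ∑ i, θ i • p i) (y : ℝ) :
    ((x, y) : (Fin n → ℝ) × ℝ) ∈
        convexHull ℝ
          (Set.range (fun i => (p i, L i)) ∪ Set.range (fun i => (p i, U i))) ↔
      ∑ i, θ i * L i ≤ y ∧ y ≤ ∑ i, θ i * U i := by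
  constructor
  · intro h
    let S : Set ((Fin n → ℝ) × ℝ) := {z | ∃ w : Fin (m + 1) → ℝ, ∑ i, w i = 1 ∧
      z.1 = ∑ i, w i • p i ∧ ∑ i, w i * L i ≤ z.2 ∧ z.2 ≤ ∑ i, w i * U i}
    have hS : Convex ℝ S := by
      rintro z ⟨w, h1, h2, h3, h4⟩ z' ⟨w', h1', h2', h3', h4'⟩ a b ha hb hab
      have key : ∀ V : Fin (m + 1) → ℝ, ∑ i, (a * w i + b * w' i) * V i
          = a * ∑ i, w i * V i + b * ∑ i, w' i * V i := by
        intro V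
        rw [Finset.mul_sum, Finset.mul_sum, ← Finset.sum_add_distrib]
        exact Finset.sum_congr rfl fun i _ => by ring
      refine ⟨fun i => a * w i + b * w' i, ?_, ?_, ?_, ?_⟩
      · rw [Finset.sum_add_distrib, ← Finset.mul_sum, ← Finset.mul_sum, h1, h1']
        linarith
      · simp only [Prod.fst_add, Prod.smul_fst, h2, h2', Finset.smul_sum, add_smul, mul_smul,
          Finset.sum_add_distrib]
      · simp only [Prod.snd_add, Prod.smul_snd, smul_eq_mul, key]
        gcongr
      · simp only [Prod.snd_add, Prod.smul_snd, smul_eq_mul, key]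
        gcongr
    have hsub : Set.range (fun i => (p i, L i)) ∪ Set.range (fun i => (p i, U i)) ⊆ S := by
      rintro z (⟨i, rfl⟩ | ⟨i, rfl⟩) <;> refine ⟨Pi.single i 1, ?_, ?_, ?_, ?_⟩ <;>
        simp [Pi.single_apply, hLU i]
    obtain ⟨w, h1, h2, h3, h4⟩ := convexHull_min hsub hS h
    have hw : w = θ := by
      funext i
      have := affineIndependent_iff.1 hp Finset.univ (fun i => w i - θ i)
        (by simp [Finset.sum_sub_distrib, h1, hθ1])
        (by simp only [sub_smul, Finset.sum_sub_distrib]; rw [← h2, ← hx]; simp) i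
        (Finset.mem_univ i)
      linarith
    subst hw
    exact ⟨h3, h4⟩
  · rintro ⟨h1, h2⟩
    set C := convexHull ℝ
          (Set.range (fun i => (p i, L i)) ∪ Set.range (fun i => (p i, U i))) with hC
    have hc : Convex ℝ C := convex_convexHull ℝ _
    have key : ∀ V : Fin (m + 1) → ℝ, (∀ i, (p i, V i) ∈ C) → (x, ∑ i, θ i * V i) ∈ C := by
      intro V hV
      have := hc.sum_mem (t := Finset.univ) (w := θ) (z := fun i => (p i, V i))
        (fun i _ => hθ i) hθ1 (fun i _ => hV i)
      convert this using 1
      ext1 <;> simp [Prod.fst_sum, Prod.snd_sum, hx]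
    have hA := key L fun i => subset_convexHull ℝ _ (Or.inl ⟨i, rfl⟩)
    have hB := key U fun i => subset_convexHull ℝ _ (Or.inr ⟨i, rfl⟩)
    have hy : y ∈ segment ℝ (∑ i, θ i * L i) (∑ i, θ i * U i) := by
      rw [segment_eq_Icc (h1.trans h2)]
      exact ⟨h1, h2⟩
    obtain ⟨a, b, ha, hb, hab, e⟩ := hy
    have := hc hA hB ha hb hab
    convert this using 1
    ext1
    · simp [← add_smul, hab]
    · simp [← e]
end

section
/- Let k < n be natural numbers, let j : Fin k → Fin n be injective, let P be a nonempty finite set of points of ℝ^k (functions Fin k → ℝ) whose affine span over ℝ is all of Fin k → ℝ, and let pl, pu : Fin n → ℝ satisfy pl i < pu i for every index i not in the range of j. Then the affine span over ℝ of the lifted point set P' = {y : Fin n → ℝ : y∘j ∈ P and for every i not in the range of j, y i ∈ {pl i, pu i}} is all of Fin n → ℝ; that is, P' is full-dimensional. -/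
theorem lifted_pointset_fullDimensional (k n : ℕ) (hkn : k < n)
    (j : Fin k → Fin n) (hj : Function.Injective j)
    (P : Set (Fin k → ℝ)) (hPne : P.Nonempty) (hPfin : P.Finite)
    (hPfull : affineSpan ℝ P = ⊤)
    (pl pu : Fin n → ℝ) (hlt : ∀ i : Fin n, i ∉ Set.range j → pl i < pu i) :
    affineSpan ℝ
        {y : Fin n → ℝ |
          (y ∘ j) ∈ P ∧ ∀ i : Fin n, i ∉ Set.range j → y i ∈ ({pl i, pu i} : Set ℝ)} =
      ⊤ := by
  classical
  set Q : Set (Fin n → ℝ) := {y : Fin n → ℝ |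
          (y ∘ j) ∈ P ∧ ∀ i : Fin n, i ∉ Set.range j → y i ∈ ({pl i, pu i} : Set ℝ)} with hQ
  let L : (Fin k → ℝ) →ᵃ[ℝ] (Fin n → ℝ) :=
    (Function.ExtendByZero.linearMap ℝ j).toAffineMap +
      AffineMap.const ℝ (Fin k → ℝ) (Function.extend j (0 : Fin k → ℝ) pl)
  have hL1 : ∀ x a, L x (j a) = x a := by
    intro x a
    simp [L, hj.extend_apply]
  have hL2 : ∀ x i, i ∉ Set.range j → L x i = pl i := by
    intro x i hi
    have hi' : ¬ ∃ a, j a = i := hi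
    simp [L, Function.extend_apply' _ _ _ hi']
  have hLQ : ∀ x ∈ P, L x ∈ Q := by
    intro x hx
    refine ⟨?_, fun i hi => Or.inl (hL2 x i hi)⟩
    have : L x ∘ j = x := funext fun a => hL1 x a
    rwa [this]
  have hLS : ∀ x, L x ∈ affineSpan ℝ Q := by
    intro x
    have h1 : (affineSpan ℝ P) ≤ (affineSpan ℝ Q).comap L :=
      affineSpan_le.2 fun x hx => subset_affineSpan ℝ Q (hLQ x hx)
    rw [hPfull] at h1
    exact h1 (AffineSubspace.mem_top ℝ _ x)
  have hdir : ∀ i, i ∉ Set.range j → ∀ c : ℝ, Pi.single i c ∈ (affineSpan ℝ Q).direction := by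
    intro i hi c
    obtain ⟨p, hp⟩ := hPne
    have h0 := hLQ p hp
    have h1 : Function.update (L p) i (pu i) ∈ Q := by
      refine ⟨?_, fun i' hi' => ?_⟩
      · have : Function.update (L p) i (pu i) ∘ j = p := by
          funext a
          have : j a ≠ i := fun h => hi ⟨a, h⟩
          simp [Function.update_of_ne this, hL1]
        rwa [this]
      · by_cases h : i' = i
        · subst h; simp
        · rw [Function.update_of_ne h]; exact h0.2 i' hi'
    have h2 := AffineSubspace.vsub_mem_direction (subset_affineSpan ℝ Q h1)
      (subset_affineSpan ℝ Q h0)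
    have h3 := Submodule.smul_mem _ (c / (pu i - pl i)) h2
    convert h3 using 1
    have hne : pu i - pl i ≠ 0 := (sub_pos.2 (hlt i hi)).ne'
    funext i'
    by_cases h : i' = i
    · subst h; simp [hL2 p i' hi, hne]
    · simp [h]
  rw [eq_top_iff]
  intro y _
  have hd : y - L (y ∘ j) ∈ (affineSpan ℝ Q).direction := by
    rw [← Finset.univ_sum_single (y - L (y ∘ j))]
    refine Submodule.sum_mem _ fun i _ => ?_
    by_cases hi : i ∈ Set.range j
    · obtain ⟨a, rfl⟩ := hi
      simp [hL1]
    · exact hdir i hi _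
  have := AffineSubspace.vadd_mem_of_mem_direction hd (hLS (y ∘ j))
  simpa using this
end

section
/- For all real numbers l, u, x, y with l ≤ 0 ≤ u, the following are equivalent: (i) there exists δ ∈ {0, 1} such that y ≤ x − l·(1 − δ), y ≥ x, y ≤ u·δ, and y ≥ 0; (ii) l ≤ x ≤ u and y = max(x, 0). That is, the big-M mixed-integer constraints exactly encode the ReLU function together with the bounds l ≤ x ≤ u. -/
theorem relu_bigM_encoding (l u x y : ℝ) (hl : l ≤ 0) (hu : 0 ≤ u) :
    (∃ δ : ℝ, (δ = 0 ∨ δ = 1) ∧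
        y ≤ x - l * (1 - δ) ∧ y ≥ x ∧ y ≤ u * δ ∧ y ≥ 0) ↔
      (l ≤ x ∧ x ≤ u ∧ y = max x 0) := by
  constructor
  · rintro ⟨δ, rfl | rfl, h1, h2, h3, h4⟩
    · refine ⟨by linarith, by linarith, ?_⟩
      rw [max_eq_right (by linarith)]
      linarith
    · refine ⟨by linarith, by linarith, ?_⟩
      rw [max_eq_left (by linarith)]
      linarith
  · rintro ⟨h1, h2, rfl⟩
    rcases le_total x 0 with h | h
    · refine ⟨0, Or.inl rfl, ?_⟩
      rw [max_eq_right h]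
      refine ⟨by linarith, by linarith, by linarith, by linarith⟩
    · refine ⟨1, Or.inr rfl, ?_⟩
      rw [max_eq_left h]
      refine ⟨by linarith, by linarith, by linarith, by linarith⟩
end

section
/- Consider a discrete-time neural feedback system of dimension n with state-update functions f₁,…,f_n : ℝⁿ → ℝ, control function u : ℝⁿ → ℝⁿ, perturbation error set E ⊆ ℝⁿ, and time-step size δ ≥ 0. Let T be a natural number, let I ⊆ ℝⁿ be a set of initial states, let G ⊆ ℝⁿ be a goal set, and let X̂₀,…,X̂_T ⊆ ℝⁿ satisfy I ⊆ X̂₀ and next(X̂_t) ⊆ X̂_{t+1} for all t < T. If there exists t* ≤ T with X̂_{t*} ⊆ G, then for every initial state x₀ ∈ I there exists t ≤ T such that τ({x₀})_t ⊆ G (the system satisfies the reach property). -/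
/-- The next-state map of a discrete-time neural feedback system. -/
def nextSet (n : ℕ) (f : Fin n → (Fin n → ℝ) → ℝ) (u : (Fin n → ℝ) → (Fin n → ℝ))
    (E : Set (Fin n → ℝ)) (δ : ℝ) (S : Set (Fin n → ℝ)) : Set (Fin n → ℝ) :=
  {y | ∃ x ∈ S, ∃ ε ∈ E, ∀ i, y i = x i + (f i x + u x i + ε i) * δ}

/-- The trajectory of a set of states under a discrete-time neural feedback system. -/
def traj (n : ℕ) (f : Fin n → (Fin n → ℝ) → ℝ) (u : (Fin n → ℝ) → (Fin n → ℝ))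
    (E : Set (Fin n → ℝ)) (δ : ℝ) (S₀ : Set (Fin n → ℝ)) : ℕ → Set (Fin n → ℝ)
  | 0 => S₀
  | t + 1 => nextSet n f u E δ (traj n f u E δ S₀ t)

theorem overapprox_reach (n : ℕ)
    (f : Fin n → (Fin n → ℝ) → ℝ) (u : (Fin n → ℝ) → (Fin n → ℝ))
    (E : Set (Fin n → ℝ)) (δ : ℝ) (hδ : 0 ≤ δ)
    (T : ℕ) (I G : Set (Fin n → ℝ)) (Xhat : ℕ → Set (Fin n → ℝ))
    (h0 : I ⊆ Xhat 0)
    (hstep : ∀ t < T, nextSet n f u E δ (Xhat t) ⊆ Xhat (t + 1))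
    (hgoal : ∃ tstar ≤ T, Xhat tstar ⊆ G) :
    ∀ x₀ ∈ I, ∃ t ≤ T, traj n f u E δ {x₀} t ⊆ G := by
  intro x₀ hx₀
  obtain ⟨ts, hts, hG⟩ := hgoal
  have key : ∀ t, t ≤ T → traj n f u E δ {x₀} t ⊆ Xhat t := by
    intro t
    induction t with
    | zero =>
      intro _ y hy
      have hy' : y = x₀ := hy
      rw [hy']
      exact h0 hx₀
    | succ t ih =>
      intro ht y hy
      obtain ⟨x, hx, hε⟩ := hy
      exact hstep t (by omega) ⟨x, ih (by omega) hx, hε⟩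
  exact ⟨ts, hts, (key ts hts).trans hG⟩
end
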